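/- Let n ≥ 1 and C ≥ 0. There exists a constant c = c(n, C) > 0 with the following property: for every r ∈ (0,1], every ε with 0 < ε ≤ r², every x₀ ∈ ℝⁿ, t₀ ∈ ℝ, and every smooth function f : ℝⁿ × ℝ → ℝ that is nonnegative on B_r(x₀) × (t₀−r², t₀+r²) and satisfies the pointwise differential inequality −ε ∂²_t f + ∂_t f − Δf ≤ C f on B_r(x₀) × (t₀−r², t₀+r²), one has sup_{B_{r/2}(x₀) × (t₀−r²/4, t₀+r²/4)} f ≤ (c / r^{n+2}) ∫_{t₀−r²}^{t₀+r²} ∫_{B_r(x₀)} f(x,t) dx dt. -/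

import Mathlib

open Set MeasureTheory Metric

/-- The spatial Laplacian `Δf(x) = Σⱼ ∂²f/∂xⱼ²` of `f : ℝⁿ → ℝ`. -/
noncomputable def spatialLaplacian {n : ℕ} (f : EuclideanSpace ℝ (Fin n) → ℝ)
    (x : EuclideanSpace ℝ (Fin n)) : ℝ :=
  ∑ j, fderiv ℝ (fun y => fderiv ℝ f y (EuclideanSpace.single j 1)) x
    (EuclideanSpace.single j 1)


open scoped ContDiff

/-- directional derivative -/
noncomputable def dirD {X : Type*} [NormedAddCommGroup X] [NormedSpace ℝ X] (e : X) (g : X → ℝ) :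
    X → ℝ := fun p => fderiv ℝ g p e

/-- the space-time -/
abbrev XT (n : ℕ) := EuclideanSpace ℝ (Fin n) × ℝ

instance XT_haar (n : ℕ) : (volume : Measure (XT n)).IsAddHaarMeasure :=
  Measure.prod.instIsAddHaarMeasure _ _

/-- space directions -/
noncomputable def eS {n : ℕ} (j : Fin n) : XT n := (EuclideanSpace.single j 1, 0)
/-- time direction -/
noncomputable def eT (n : ℕ) : XT n := (0, 1)

section general
variable {X : Type*} [NormedAddCommGroup X] [NormedSpace ℝ X]

theorem dirD_contDiff {g : X → ℝ} (e : X) (hg : ContDiff ℝ ∞ g) : ContDiff ℝ ∞ (dirD e g) := by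
  have h : ContDiff ℝ ∞ (fderiv ℝ g) := hg.fderiv_right (by simp)
  exact h.clm_apply contDiff_const

theorem dirD_mul {g h : X → ℝ} (e : X) (hg : ContDiff ℝ ∞ g) (hh : ContDiff ℝ ∞ h) :
    dirD e (fun p => g p * h p) = fun p => g p * dirD e h p + dirD e g p * h p := by
  funext p
  unfold dirD
  rw [fderiv_fun_mul (hg.differentiable (by simp) p) (hh.differentiable (by simp) p)]
  simp [mul_comm]

theorem dirD_add {g h : X → ℝ} (e : X) (hg : ContDiff ℝ ∞ g) (hh : ContDiff ℝ ∞ h) :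
    dirD e (fun p => g p + h p) = fun p => dirD e g p + dirD e h p := by
  funext p
  unfold dirD
  rw [fderiv_fun_add (hg.differentiable (by simp) p) (hh.differentiable (by simp) p)]
  simp

theorem dirD_hasCompactSupport {g : X → ℝ} (e : X) (hg : HasCompactSupport g) :
    HasCompactSupport (dirD e g) := hg.fderiv_apply ℝ e

theorem dirD_zero_of_eventuallyEq {g : X → ℝ} (e : X) (p : X) (c : ℝ)
    (h : g =ᶠ[nhds p] fun _ => c) : dirD e g =ᶠ[nhds p] fun _ => 0 := by
  filter_upwards [h.eventually_nhds] with q hq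
  unfold dirD
  rw [Filter.EventuallyEq.fderiv_eq hq]
  simp

theorem dirD2_mul {g h : X → ℝ} (e : X) (hg : ContDiff ℝ ∞ g) (hh : ContDiff ℝ ∞ h) :
    dirD e (dirD e (fun p => g p * h p)) = fun p => g p * dirD e (dirD e h) p
      + (2 * (dirD e g p * dirD e h p) + dirD e (dirD e g) p * h p) := by
  have hg' := dirD_contDiff e hg
  have hh' := dirD_contDiff e hh
  rw [dirD_mul e hg hh, dirD_add e (hg.mul hh') (hg'.mul hh), dirD_mul e hg hh', dirD_mul e hg' hh]
  funext p
  ring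

theorem dirD_comp {Y : Type*} [NormedAddCommGroup Y] [NormedSpace ℝ Y] {g : Y → ℝ}
    (hg : ContDiff ℝ ∞ g) (L : X →L[ℝ] Y) (y : Y) (e : X) (e' : Y) (c : ℝ) (hL : L e = c • e') :
    dirD e (fun p => g (y + L p)) = fun p => c * dirD e' g (y + L p) := by
  funext p
  unfold dirD
  have h1 : HasFDerivAt (fun p => y + L p) L p := L.hasFDerivAt.const_add y
  have h2 := (hg.differentiable (by simp) (y + L p)).hasFDerivAt.comp p h1
  have := h2.fderiv
  simp only [Function.comp_def] at this
  rw [this]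
  simp [hL]

theorem dirD_const_mul {g : X → ℝ} (hg : ContDiff ℝ ∞ g) (e : X) (c : ℝ) :
    dirD e (fun p => c * g p) = fun p => c * dirD e g p := by
  funext p
  unfold dirD
  rw [fderiv_const_mul (hg.differentiable (by simp) p)]
  simp

theorem dirD2_comp {Y : Type*} [NormedAddCommGroup Y] [NormedSpace ℝ Y] {g : Y → ℝ}
    (hg : ContDiff ℝ ∞ g) (L : X →L[ℝ] Y) (y : Y) (e : X) (e' : Y) (c : ℝ) (hL : L e = c • e') :
    dirD e (dirD e (fun p => g (y + L p))) = fun p => c ^ 2 * dirD e' (dirD e' g) (y + L p) := by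
  have hg' := dirD_contDiff e' hg
  rw [dirD_comp hg L y e e' c hL, dirD_const_mul _ e c, dirD_comp hg' L y e e' c hL]
  · funext p; ring
  · exact hg'.comp (contDiff_const.add L.contDiff)

theorem dirD_ibp {n : ℕ} {u w : XT n → ℝ} (e : XT n)
    (hu : ContDiff ℝ ∞ u) (hw : ContDiff ℝ ∞ w) (hc : HasCompactSupport w) :
    ∫ p, u p * dirD e w p = - ∫ p, dirD e u p * w p := by
  have hu' := dirD_contDiff e hu
  have hw' := dirD_contDiff e hw
  apply integral_mul_fderiv_eq_neg_fderiv_mul_of_integrable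
  · exact (hu'.continuous.mul hw.continuous).integrable_of_hasCompactSupport hc.mul_left
  · exact (hu.continuous.mul hw'.continuous).integrable_of_hasCompactSupport
      (dirD_hasCompactSupport e hc).mul_left
  · exact (hu.continuous.mul hw.continuous).integrable_of_hasCompactSupport hc.mul_left
  · exact fun x _ => hu.differentiable (by simp) x
  · exact fun x _ => hw.differentiable (by simp) x

theorem dirD2_ibp {n : ℕ} {u w : XT n → ℝ} (e : XT n)
    (hu : ContDiff ℝ ∞ u) (hw : ContDiff ℝ ∞ w) (hc : HasCompactSupport w) :
    ∫ p, u p * dirD e (dirD e w) p = ∫ p, dirD e (dirD e u) p * w p := by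
  rw [dirD_ibp e hu (dirD_contDiff e hw) (dirD_hasCompactSupport e hc),
    dirD_ibp e (dirD_contDiff e hu) hw hc, neg_neg]

end general

/-- the kernel -/
noncomputable def hker (n : ℕ) (ε v : ℝ) (q : XT n) : ℝ :=
  (v ^ (n + 1))⁻¹ * Real.exp (-(‖q.1‖ ^ 2 / (4 * v ^ 2)) - (q.2 + v ^ 2) ^ 2 / (4 * ε * v ^ 2))

section kernel
variable {n : ℕ} {ε v : ℝ}

theorem hker_contDiff : ContDiff ℝ ∞ (hker n ε v) := by
  unfold hker
  have h1 : ContDiff ℝ ∞ (fun q : XT n => ‖q.1‖ ^ 2) := contDiff_fst.norm_sq ℝ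
  have h2 : ContDiff ℝ ∞ (fun q : XT n => q.2) := contDiff_snd
  exact contDiff_const.mul (((h1.div_const _).neg.sub
    (((h2.add contDiff_const).pow 2).div_const _)).exp)

theorem hker_nonneg (hv : 0 ≤ v) (q : XT n) : 0 ≤ hker n ε v q := by
  unfold hker; positivity

theorem hker_hasFDerivAt (q : XT n) : HasFDerivAt (hker n ε v)
    (hker n ε v q • (-((1 / (4 * v ^ 2)) • ((2 • (innerSL ℝ q.1)).comp
      (ContinuousLinearMap.fst ℝ (EuclideanSpace ℝ (Fin n)) ℝ)))
      - (1 / (4 * ε * v ^ 2)) • (2 * (q.2 + v ^ 2)) • 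
        (ContinuousLinearMap.snd ℝ (EuclideanSpace ℝ (Fin n)) ℝ))) q := by
  have h1 : HasFDerivAt (fun q : XT n => ‖q.1‖ ^ 2) _ q :=
    (hasStrictFDerivAt_norm_sq q.1).hasFDerivAt.comp q hasFDerivAt_fst
  have h2 : HasFDerivAt (fun q : XT n => (q.2 + v ^ 2) ^ 2) _ q :=
    ((hasFDerivAt_snd (𝕜 := ℝ) (p := q)).add_const (v ^ 2)).pow 2
  have h3 := ((((h1.const_mul (1 / (4 * v ^ 2))).neg.sub
    (h2.const_mul (1 / (4 * ε * v ^ 2)))).exp).const_mul ((v ^ (n + 1))⁻¹))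
  have e1 : hker n ε v = fun q : XT n => (v ^ (n + 1))⁻¹ *
    Real.exp (-(1 / (4 * v ^ 2) * ‖q.1‖ ^ 2) - 1 / (4 * ε * v ^ 2) * (q.2 + v ^ 2) ^ 2) := by
    funext q
    unfold hker
    congr 2
    ring
  rw [e1]
  refine HasFDerivAt.congr_fderiv h3 ?_
  ext p
  · simp
    ring
  · simp
    ring

theorem hker_dS (j : Fin n) :
    dirD (eS j) (hker n ε v) = fun q => (-1 / (2 * v ^ 2)) * (q.1 j * hker n ε v q) := by
  funext q
  unfold dirD
  rw [(hker_hasFDerivAt q).fderiv]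
  simp [eS, EuclideanSpace.inner_single_right]
  ring

theorem hker_dT :
    dirD (eT n) (hker n ε v) =
      fun q => (-1 / (2 * ε * v ^ 2)) * ((q.2 + v ^ 2) * hker n ε v q) := by
  funext q
  unfold dirD
  rw [(hker_hasFDerivAt q).fderiv]
  simp [eT]
  ring

theorem hker_dSS (j : Fin n) :
    dirD (eS j) (dirD (eS j) (hker n ε v)) =
      fun q => ((q.1 j) ^ 2 / (4 * v ^ 4) - 1 / (2 * v ^ 2)) * hker n ε v q := by
  have hx : ContDiff ℝ ∞ (fun q : XT n => q.1 j) := by fun_prop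
  rw [hker_dS, dirD_const_mul (hx.mul hker_contDiff), dirD_mul _ hx hker_contDiff, hker_dS]
  have : dirD (eS j) (fun q : XT n => q.1 j) = fun _ => 1 := by
    funext q
    have h : HasFDerivAt (fun q : XT n => q.1 j) ((EuclideanSpace.proj j : 
      EuclideanSpace ℝ (Fin n) →L[ℝ] ℝ).comp (ContinuousLinearMap.fst ℝ _ ℝ)) q :=
      ((EuclideanSpace.proj j : EuclideanSpace ℝ (Fin n) →L[ℝ] ℝ).comp 
        (ContinuousLinearMap.fst ℝ _ ℝ)).hasFDerivAt
    unfold dirD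
    rw [h.fderiv]
    simp [eS]
  rw [this]
  funext q
  ring

theorem hker_dTT :
    dirD (eT n) (dirD (eT n) (hker n ε v)) =
      fun q => ((q.2 + v ^ 2) ^ 2 / (4 * ε ^ 2 * v ^ 4) - 1 / (2 * ε * v ^ 2)) * hker n ε v q := by
  have hx : ContDiff ℝ ∞ (fun q : XT n => q.2 + v ^ 2) := by fun_prop
  rw [hker_dT, dirD_const_mul (hx.mul hker_contDiff), dirD_mul _ hx hker_contDiff, hker_dT]
  have : dirD (eT n) (fun q : XT n => q.2 + v ^ 2) = fun _ => 1 := by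
    funext q
    have h : HasFDerivAt (fun q : XT n => q.2 + v ^ 2) (ContinuousLinearMap.snd ℝ _ ℝ) q :=
      hasFDerivAt_snd.add_const _
    unfold dirD
    rw [h.fderiv]
    simp [eT]
  rw [this]
  funext q
  ring

/-- adjoint operator -/
noncomputable def Lstar (ε : ℝ) (w : XT n → ℝ) (q : XT n) : ℝ :=
  ∑ j, dirD (eS j) (dirD (eS j) w) q + ε * dirD (eT n) (dirD (eT n) w) q + dirD (eT n) w q

/-- operator -/
noncomputable def Lop (ε : ℝ) (w : XT n → ℝ) (q : XT n) : ℝ :=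
  ∑ j, dirD (eS j) (dirD (eS j) w) q + ε * dirD (eT n) (dirD (eT n) w) q - dirD (eT n) w q

theorem hker_Lstar (hε : ε ≠ 0) (hv : v ≠ 0) (q : XT n) : Lstar ε (hker n ε v) q =
    (‖q.1‖ ^ 2 / (4 * v ^ 4) - (n : ℝ) / (2 * v ^ 2) + 
      ((q.2 + v ^ 2) ^ 2 / (4 * ε * v ^ 4) - 1 / (2 * v ^ 2)) - 
      (q.2 + v ^ 2) / (2 * ε * v ^ 2)) * hker n ε v q := by
  unfold Lstar
  rw [hker_dTT, hker_dT]
  simp only [hker_dSS]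
  rw [← Finset.sum_mul, Finset.sum_sub_distrib, ← Finset.sum_div, EuclideanSpace.real_norm_sq_eq]
  simp
  field_simp
  ring

theorem hker_hasDerivAt (hε : ε ≠ 0) (hv : v ≠ 0) (q : XT n) :
    HasDerivAt (fun v => hker n ε v q) (2 * v * Lstar ε (hker n ε v) q) v := by
  rw [hker_Lstar hε hv]
  unfold hker
  have hp : HasDerivAt (fun v : ℝ => v ^ 2) (2 * v) v := by simpa using hasDerivAt_pow 2 v
  have h0 : HasDerivAt (fun v : ℝ => (v ^ (n + 1))⁻¹) _ v :=
    (hasDerivAt_pow (n + 1) v).inv (by positivity)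
  have h1 : HasDerivAt (fun v : ℝ => ‖q.1‖ ^ 2 / (4 * v ^ 2)) _ v :=
    (hasDerivAt_const v (‖q.1‖ ^ 2)).div (hp.const_mul 4) (by positivity)
  have h2 : HasDerivAt (fun v : ℝ => (q.2 + v ^ 2) ^ 2 / (4 * ε * v ^ 2)) _ v :=
    ((hp.const_add q.2).pow 2).div (hp.const_mul (4 * ε)) (by positivity)
  refine HasDerivAt.congr_deriv (h0.mul ((h1.neg.sub h2).exp)) ?_
  simp
  field_simp
  ring

end kernel

section parts
variable {n : ℕ} {ε : ℝ}

/-- commutator -/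
noncomputable def Rem (ε : ℝ) (φ p : XT n → ℝ) (q : XT n) : ℝ :=
  ∑ j, (2 * (dirD (eS j) φ q * dirD (eS j) p q) + dirD (eS j) (dirD (eS j) φ) q * p q)
    + ε * (2 * (dirD (eT n) φ q * dirD (eT n) p q) + dirD (eT n) (dirD (eT n) φ) q * p q)
    + dirD (eT n) φ q * p q

theorem Lstar_mul {φ p : XT n → ℝ} (hφ : ContDiff ℝ ∞ φ) (hp : ContDiff ℝ ∞ p) (q : XT n) :
    Lstar ε (fun q => φ q * p q) q = φ q * Lstar ε p q + Rem ε φ p q := by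
  unfold Lstar Rem
  rw [dirD2_mul _ hφ hp, dirD_mul _ hφ hp]
  simp only [dirD2_mul _ hφ hp, Finset.sum_add_distrib, ← Finset.mul_sum]
  ring

theorem Lstar_continuous {w : XT n → ℝ} (hw : ContDiff ℝ ∞ w) : Continuous (Lstar ε w) := by
  have h1 : ∀ e : XT n, Continuous (dirD e w) := fun e => (dirD_contDiff e hw).continuous
  have h2 : ∀ e : XT n, Continuous (dirD e (dirD e w)) := fun e =>
    (dirD_contDiff e (dirD_contDiff e hw)).continuous
  exact ((continuous_finsetSum _ fun j _ => h2 _).add ((h2 _).const_mul ε)).add (h1 _)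

theorem Lop_continuous {w : XT n → ℝ} (hw : ContDiff ℝ ∞ w) : Continuous (Lop ε w) := by
  have h1 : ∀ e : XT n, Continuous (dirD e w) := fun e => (dirD_contDiff e hw).continuous
  have h2 : ∀ e : XT n, Continuous (dirD e (dirD e w)) := fun e =>
    (dirD_contDiff e (dirD_contDiff e hw)).continuous
  exact ((continuous_finsetSum _ fun j _ => h2 _).add ((h2 _).const_mul ε)).sub (h1 _)

theorem Rem_continuous {φ p : XT n → ℝ} (hφ : ContDiff ℝ ∞ φ) (hp : ContDiff ℝ ∞ p) :
    Continuous (Rem ε φ p) := by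
  have : Rem ε φ p = fun q => Lstar ε (fun q => φ q * p q) q - φ q * Lstar ε p q := by
    funext q
    rw [Lstar_mul hφ hp]; ring
  rw [this]
  exact (Lstar_continuous (hφ.mul hp)).sub (hφ.continuous.mul (Lstar_continuous hp))

theorem Lstar_ibp {u w : XT n → ℝ} (hu : ContDiff ℝ ∞ u) (hw : ContDiff ℝ ∞ w)
    (hc : HasCompactSupport w) : ∫ q, u q * Lstar ε w q = ∫ q, Lop ε u q * w q := by
  have i1 : ∀ e : XT n, Integrable (fun q => u q * dirD e w q) := fun e =>
    (hu.continuous.mul (dirD_contDiff e hw).continuous).integrable_of_hasCompactSupport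
      (dirD_hasCompactSupport e hc).mul_left
  have i2 : ∀ e : XT n, Integrable (fun q => u q * dirD e (dirD e w) q) := fun e =>
    (hu.continuous.mul (dirD_contDiff e
      (dirD_contDiff e hw)).continuous).integrable_of_hasCompactSupport
      (dirD_hasCompactSupport e (dirD_hasCompactSupport e hc)).mul_left
  have k1 : ∀ e : XT n, Integrable (fun q => dirD e u q * w q) := fun e =>
    ((dirD_contDiff e hu).continuous.mul hw.continuous).integrable_of_hasCompactSupport
      hc.mul_left
  have k2 : ∀ e : XT n, Integrable (fun q => dirD e (dirD e u) q * w q) := fun e =>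
    ((dirD_contDiff e (dirD_contDiff e hu)).continuous.mul
      hw.continuous).integrable_of_hasCompactSupport hc.mul_left
  have e1 : ∀ q, u q * Lstar ε w q = (∑ j, u q * dirD (eS j) (dirD (eS j) w) q
      + ε * (u q * dirD (eT n) (dirD (eT n) w) q)) + u q * dirD (eT n) w q := by
    intro q; unfold Lstar; rw [← Finset.mul_sum]; ring
  have e2 : ∀ q, Lop ε u q * w q = (∑ j, dirD (eS j) (dirD (eS j) u) q * w q
      + ε * (dirD (eT n) (dirD (eT n) u) q * w q)) - dirD (eT n) u q * w q := by
    intro q; unfold Lop; rw [← Finset.sum_mul]; ring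
  simp_rw [e1, e2]
  rw [integral_add, integral_sub, integral_add, integral_add, integral_finsetSum,
    integral_finsetSum, integral_const_mul, integral_const_mul, dirD2_ibp _ hu hw hc,
    dirD_ibp _ hu hw hc]
  · simp_rw [dirD2_ibp _ hu hw hc]
    ring
  all_goals first
    | exact fun i _ => k2 _
    | exact fun i _ => i2 _
    | exact integrable_finsetSum _ fun i _ => k2 _
    | exact integrable_finsetSum _ fun i _ => i2 _
    | exact (k2 _).const_mul _
    | exact (i2 _).const_mul _
    | exact k1 _
    | exact i1 _
    | exact (integrable_finsetSum _ fun i _ => k2 _).add ((k2 _).const_mul _)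
    | exact (integrable_finsetSum _ fun i _ => i2 _).add ((i2 _).const_mul _)

end parts

section bounds

theorem gauss_cmp {ε v t : ℝ} (hε : 0 < ε) (hv : 0 < v) :
    Real.exp (-((t + v ^ 2) ^ 2 / (8 * ε * v ^ 2))) ≤
      Real.exp (-(1 / (8 * ε)) * (v - √(max (-t) 0)) ^ 2) := by
  apply Real.exp_le_exp.2
  set b := √(max (-t) 0) with hb
  have hb0 : 0 ≤ b := Real.sqrt_nonneg _
  have hb2 : b ^ 2 = max (-t) 0 := Real.sq_sqrt (le_max_right _ _)
  have key : (v - b) ^ 2 * v ^ 2 ≤ (t + v ^ 2) ^ 2 := by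
    rcases le_total 0 t with h | h
    · rw [max_eq_right (by linarith)] at hb2
      have : b = 0 := by simpa using hb2
      rw [this]
      nlinarith [mul_nonneg h (sq_nonneg v)]
    · rw [max_eq_left (by linarith)] at hb2
      have e : t + v ^ 2 = (v - b) * (v + b) := by linear_combination hb2
      rw [e, mul_pow]
      gcongr
      linarith
  have : (v - b) ^ 2 / (8 * ε) ≤ (t + v ^ 2) ^ 2 / (8 * ε * v ^ 2) := by
    rw [div_le_div_iff₀ (by positivity) (by positivity)]
    nlinarith [mul_le_mul_of_nonneg_left key (by positivity : 0 ≤ 8 * ε)]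
  have e2 : -(1 / (8 * ε)) * (v - b) ^ 2 = - ((v - b) ^ 2 / (8 * ε)) := by ring
  rw [e2]
  linarith

theorem inv_pow_exp {a v : ℝ} (k : ℕ) (ha : 0 < a) (hv : 0 < v) (hv1 : v ≤ 1) :
    (v ^ k)⁻¹ * Real.exp (-(a / v ^ 2)) ≤ k.factorial / a ^ k := by
  have h1 : (a / v ^ 2) ^ k / k.factorial ≤ Real.exp (a / v ^ 2) :=
    Real.pow_div_factorial_le_exp _ (by positivity) k
  rw [Real.exp_neg, ← mul_inv]
  rw [inv_le_comm₀ (by positivity) (by positivity), inv_div]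
  calc a ^ k / k.factorial = v ^ k * v ^ k * ((a / v ^ 2) ^ k / k.factorial) := by
        rw [div_pow]; field_simp; ring
    _ ≤ v ^ k * 1 * ((a / v ^ 2) ^ k / k.factorial) := by
        gcongr
        exact pow_le_one₀ hv.le hv1
    _ ≤ v ^ k * Real.exp (a / v ^ 2) := by
        rw [mul_one]; gcongr

variable {n : ℕ}

theorem hker_bound1 {ε v : ℝ} (hε : 0 < ε) (hv : 0 < v) (q : XT n) :
    v ^ (n + 1) * hker n ε v q ≤ Real.exp (-(1 / (8 * ε)) * (v - √(max (-q.2) 0)) ^ 2) := by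
  refine le_trans ?_ (gauss_cmp hε hv)
  unfold hker
  rw [← mul_assoc, mul_inv_cancel₀ (by positivity), one_mul]
  apply Real.exp_le_exp.2
  have h1 : 0 ≤ ‖q.1‖ ^ 2 / (4 * v ^ 2) := by positivity
  have h2 : 0 ≤ (q.2 + v ^ 2) ^ 2 / (8 * ε * v ^ 2) := by positivity
  have h3 : (q.2 + v ^ 2) ^ 2 / (4 * ε * v ^ 2) = 2 * ((q.2 + v ^ 2) ^ 2 / (8 * ε * v ^ 2)) := by
    field_simp; ring
  linarith

theorem hker_bound2 {ε v : ℝ} (hε : 0 < ε) (hε1 : ε ≤ 1) (hv : 0 < v) (hv1 : v ≤ 1 / 4)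
    (q : XT n) (hq : 1 / 8 ≤ ‖q‖) :
    v⁻¹ * hker n ε v q ≤ ((n + 2).factorial / (1 / 2048) ^ (n + 2)) *
      Real.exp (-(1 / (8 * ε)) * (v - √(max (-q.2) 0)) ^ 2) := by
  have hA : v⁻¹ * hker n ε v q ≤ ((v ^ (n + 2))⁻¹ * Real.exp (-((1 / 2048) / v ^ 2))) *
      Real.exp (-((q.2 + v ^ 2) ^ 2 / (8 * ε * v ^ 2))) := by
    unfold hker
    rw [mul_assoc ((v ^ (n + 2))⁻¹), ← Real.exp_add, ← mul_assoc, ← mul_inv, ← pow_succ']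
    gcongr
    have h1 : 0 ≤ ‖q.1‖ ^ 2 / (4 * v ^ 2) := by positivity
    have h2 : 0 ≤ (q.2 + v ^ 2) ^ 2 / (8 * ε * v ^ 2) := by positivity
    have h3 : (q.2 + v ^ 2) ^ 2 / (4 * ε * v ^ 2) =
      2 * ((q.2 + v ^ 2) ^ 2 / (8 * ε * v ^ 2)) := by
      field_simp; ring
    rcases le_max_iff.1 (Prod.norm_def q ▸ hq) with h | h
    · have : 1 / 2048 / v ^ 2 ≤ ‖q.1‖ ^ 2 / (4 * v ^ 2) := by
        rw [div_le_div_iff₀ (by positivity) (by positivity)]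
        have : (1 / 8) ^ 2 ≤ ‖q.1‖ ^ 2 := by gcongr
        nlinarith [mul_le_mul_of_nonneg_right this (sq_nonneg v)]
      linarith
    · have hv2 : v ^ 2 ≤ 1 / 16 := by nlinarith
      have h5 : (1 / 16) ^ 2 ≤ (q.2 + v ^ 2) ^ 2 := by
        rw [Real.norm_eq_abs] at h
        rcases le_abs.1 h with h | h <;> nlinarith [sq_nonneg v]
      have : 1 / 2048 / v ^ 2 ≤ (q.2 + v ^ 2) ^ 2 / (8 * ε * v ^ 2) := by
        rw [div_le_div_iff₀ (by positivity) (by positivity)]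
        have h6 : 1 / 2048 * (8 * ε) ≤ (q.2 + v ^ 2) ^ 2 := by nlinarith
        nlinarith [mul_le_mul_of_nonneg_right h6 (sq_nonneg v)]
      linarith
  refine hA.trans ?_
  gcongr ?_ * ?_
  · exact inv_pow_exp (n + 2) (by norm_num) hv (by linarith)
  · exact gauss_cmp hε hv

theorem Rem_bound {ε v K : ℝ} {φ : XT n → ℝ} (hε : 0 < ε) (hε1 : ε ≤ 1) (hv : 0 < v)
    (hv1 : v ≤ 1 / 4) (q : XT n) (hq : ‖q‖ ≤ 1 / 4) (hK : 0 ≤ K)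
    (hS : ∀ j, |dirD (eS j) φ q| ≤ K) (hSS : ∀ j, |dirD (eS j) (dirD (eS j) φ) q| ≤ K)
    (hT : |dirD (eT n) φ q| ≤ K) (hTT : |dirD (eT n) (dirD (eT n) φ) q| ≤ K) :
    |Rem ε φ (hker n ε v) q| ≤ K * (3 * n + 4) * ((v ^ 2)⁻¹ * hker n ε v q) := by
  set p := hker n ε v q with hp
  have hp0 : 0 ≤ p := hker_nonneg hv.le q
  have hv2 : v ^ 2 ≤ 1 / 16 := by nlinarith
  set P := (v ^ 2)⁻¹ * p with hP
  have hpP : p ≤ P := by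
    have : 1 ≤ (v ^ 2)⁻¹ := (one_le_inv₀ (by positivity)).2 (by linarith)
    nlinarith
  have hP0 : 0 ≤ P := by positivity
  have hx : ‖q.1‖ ≤ 1 / 4 := (norm_fst_le q).trans hq
  have ht : |q.2| ≤ 1 / 4 := (norm_snd_le q).trans hq
  have hdS : ∀ j, |dirD (eS j) (hker n ε v) q| ≤ P := by
    intro j
    rw [hker_dS]
    beta_reduce
    have e : (-1 / (2 * v ^ 2)) * (q.1 j * hker n ε v q) = (-q.1 j / 2) * P := by
      rw [hP, ← hp]; field_simp
    rw [e, abs_mul, abs_of_nonneg hP0]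
    have : |q.1 j| ≤ 1 / 4 := by
      simpa using (PiLp.norm_apply_le q.1 j).trans hx
    have h2 : |-q.1 j / 2| ≤ 1 := by
      rw [abs_div, abs_neg, abs_two]; linarith
    nlinarith
  have hdT : ε * |dirD (eT n) (hker n ε v) q| ≤ P := by
    rw [hker_dT]
    beta_reduce
    have e : (-1 / (2 * ε * v ^ 2)) * ((q.2 + v ^ 2) * hker n ε v q) =
      (-(q.2 + v ^ 2) / 2 / ε) * P := by
      rw [hP, ← hp]; field_simp
    rw [e, abs_mul, abs_of_nonneg hP0, abs_div, abs_of_pos hε]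
    have h2 : |-(q.2 + v ^ 2) / 2| ≤ 1 := by
      rw [abs_div, abs_neg, abs_two]
      have := abs_add_le q.2 (v ^ 2)
      rw [abs_of_nonneg (sq_nonneg v)] at this
      linarith
    rw [← mul_assoc, mul_div_cancel₀ _ hε.ne']
    nlinarith
  unfold Rem
  have b1 : ∀ j, |2 * (dirD (eS j) φ q * dirD (eS j) (hker n ε v) q)
      + dirD (eS j) (dirD (eS j) φ) q * hker n ε v q| ≤ 3 * K * P := by
    intro j
    refine (abs_add_le _ _).trans ?_
    rw [abs_mul, abs_mul, abs_mul, abs_two, ← hp, abs_of_nonneg hp0]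
    have a1 := mul_le_mul (hS j) (hdS j) (abs_nonneg _) hK
    have a2 := mul_le_mul (hSS j) hpP hp0 hK
    linarith
  have b2 : |ε * (2 * (dirD (eT n) φ q * dirD (eT n) (hker n ε v) q)
      + dirD (eT n) (dirD (eT n) φ) q * hker n ε v q)| ≤ 3 * K * P := by
    rw [mul_add]
    refine (abs_add_le _ _).trans ?_
    simp only [abs_mul]
    rw [abs_two, ← hp, abs_of_nonneg hp0, abs_of_pos hε]
    have a1 := mul_le_mul hT hdT (by positivity) hK
    have a2 := mul_le_mul hTT hpP hp0 hK
    have a3 : ε * (|dirD (eT n) (dirD (eT n) φ) q| * p) ≤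
      1 * (|dirD (eT n) (dirD (eT n) φ) q| * p) := by gcongr
    nlinarith
  have b3 : |dirD (eT n) φ q * hker n ε v q| ≤ K * P := by
    rw [abs_mul, ← hp, abs_of_nonneg hp0]
    exact mul_le_mul hT hpP hp0 hK
  have b4 : |∑ j, (2 * (dirD (eS j) φ q * dirD (eS j) (hker n ε v) q)
      + dirD (eS j) (dirD (eS j) φ) q * hker n ε v q)| ≤ n * (3 * K * P) := by
    refine (Finset.abs_sum_le_sum_abs _ _).trans ?_
    refine (Finset.sum_le_sum fun j _ => b1 j).trans ?_
    simp
  refine (abs_add_le _ _).trans ?_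
  refine (add_le_add (abs_add_le _ _) le_rfl).trans ?_
  linarith

end bounds

section core
variable {n : ℕ}

theorem J_hasDerivAt {ε v : ℝ} (hε : 0 < ε) (hv : 0 < v) {g : XT n → ℝ} (hg : Continuous g)
    (hc : HasCompactSupport g) :
    HasDerivAt (fun v => ∫ q, g q * hker n ε v q)
      (∫ q, g q * (2 * v * Lstar ε (hker n ε v) q)) v := by
  have hcont : ContinuousOn (fun z : ℝ × XT n => 2 * z.1 * ((‖z.2.1‖ ^ 2 / (4 * z.1 ^ 4) -
      (n : ℝ) / (2 * z.1 ^ 2) + 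
      ((z.2.2 + z.1 ^ 2) ^ 2 / (4 * ε * z.1 ^ 4) - 1 / (2 * z.1 ^ 2)) - 
      (z.2.2 + z.1 ^ 2) / (2 * ε * z.1 ^ 2)) * ((z.1 ^ (n + 1))⁻¹ *
      Real.exp (-(‖z.2.1‖ ^ 2 / (4 * z.1 ^ 2)) - (z.2.2 + z.1 ^ 2) ^ 2 / (4 * ε * z.1 ^ 2)))))
      (Icc (v / 2) (2 * v) ×ˢ tsupport g) := by
    have hz : ∀ z ∈ Icc (v / 2) (2 * v) ×ˢ tsupport g, z.1 ≠ 0 := by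
      intro z hz
      have := hz.1.1
      intro h
      linarith
    have hε' := hε.ne'
    intro z h
    have hz0 := hz z h
    refine ContinuousAt.continuousWithinAt ?_
    fun_prop (disch := positivity)
  obtain ⟨M, hM⟩ := (isCompact_Icc.prod hc.isCompact).exists_bound_of_continuousOn hcont
  obtain ⟨N, hN⟩ := hc.isCompact.exists_bound_of_continuousOn hg.continuousOn
  refine (hasDerivAt_integral_of_dominated_loc_of_deriv_le (s := Ioo (v / 2) (2 * v))
    (F := fun v q => g q * hker n ε v q)
    (F' := fun v q => g q * (2 * v * Lstar ε (hker n ε v) q))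
    (bound := (tsupport g).indicator fun _ => N * M)
    (Ioo_mem_nhds (by linarith) (by linarith)) ?_ ?_ ?_ ?_ ?_ ?_).2
  · exact Filter.Eventually.of_forall fun v =>
      (hg.mul hker_contDiff.continuous).aestronglyMeasurable
  · exact (hg.mul hker_contDiff.continuous).integrable_of_hasCompactSupport hc.mul_right
  · exact (hg.mul (continuous_const.mul (Lstar_continuous hker_contDiff))).aestronglyMeasurable
  · refine Filter.Eventually.of_forall fun q w hw => ?_
    by_cases hq : q ∈ tsupport g
    · rw [indicator_of_mem hq, norm_mul]
      have hw0 : w ≠ 0 := by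
        intro h; have := hw.1; linarith
      have := hM (w, q) ⟨Ioo_subset_Icc_self hw, hq⟩
      rw [hker_Lstar hε.ne' hw0]
      exact mul_le_mul (hN q hq) this (norm_nonneg _) ((norm_nonneg _).trans (hN q hq))
    · rw [indicator_of_notMem hq, image_eq_zero_of_notMem_tsupport hq]
      simp
  · exact (integrable_indicator_iff (isClosed_tsupport g).measurableSet).2
      (integrableOn_const hc.isCompact.measure_lt_top.ne)
  · refine Filter.Eventually.of_forall fun q w hw => ?_
    have hw0 : w ≠ 0 := by
      intro h; have := hw.1; linarith
    exact (hker_hasDerivAt hε.ne' hw0 q).const_mul _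

/-- Gaussian majorant -/
noncomputable def Gm (n : ℕ) (ε v : ℝ) (q : XT n) : ℝ :=
  Real.exp (-(1 / (8 * ε)) * (v - √(max (-q.2) 0)) ^ 2)

theorem Gm_le_one {ε v : ℝ} (hε : 0 < ε) (q : XT n) : Gm n ε v q ≤ 1 := by
  unfold Gm
  apply Real.exp_le_one_iff.2
  have : 0 ≤ 1 / (8 * ε) * (v - √(max (-q.2) 0)) ^ 2 := by positivity
  linarith

theorem Gm_continuous {ε : ℝ} : Continuous (fun z : ℝ × XT n => Gm n ε z.1 z.2) := by
  unfold Gm; fun_prop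

theorem Gm_continuous' {ε v : ℝ} : Continuous (Gm n ε v) := by
  unfold Gm; fun_prop

theorem Gm_integral {ε : ℝ} (hε : 0 < ε) (q : XT n) :
    Integrable (fun v => Gm n ε v q) ∧ ∫ v, Gm n ε v q = √(8 * Real.pi) * √ε := by
  unfold Gm
  have h := integrable_exp_neg_mul_sq (b := 1 / (8 * ε)) (by positivity)
  refine ⟨h.comp_sub_right (√(max (-q.2) 0)), ?_⟩
  rw [integral_sub_right_eq_self (fun v => Real.exp (-(1 / (8 * ε)) * v ^ 2)), integral_gaussian,
    ← Real.sqrt_mul (by positivity)]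
  congr 1
  field_simp

theorem u_intOn {u : XT n → ℝ} (hu : Continuous u) (s : ℝ) : IntegrableOn u (ball (0 : XT n) s) :=
  (hu.continuousOn.integrableOn_compact (isCompact_closedBall (0 : XT n) s)).mono_set
    ball_subset_closedBall

theorem Psi_int {ε a b : ℝ} (hε : 0 < ε) {u : XT n → ℝ} (hu : Continuous u) :
    Integrable (Function.uncurry fun v q => u q * Gm n ε v q)
      ((volume.restrict (Ioc a b)).prod (volume.restrict (ball (0 : XT n) (1 / 4)))) := by
  have h1 : Integrable (fun z : ℝ × XT n => u z.2)
      ((volume.restrict (Ioc a b)).prod (volume.restrict (ball (0 : XT n) (1 / 4)))) :=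
    (u_intOn hu (1 / 4)).comp_snd _
  refine h1.norm.mono' ?_ ?_
  · exact ((hu.comp continuous_snd).mul Gm_continuous).aestronglyMeasurable
  · refine Filter.Eventually.of_forall fun z => ?_
    simp only [Function.uncurry, norm_mul]
    have h2 : ‖Gm n ε z.1 z.2‖ ≤ 1 := by
      rw [Real.norm_eq_abs, abs_of_nonneg (by unfold Gm; positivity)]
      exact Gm_le_one hε _
    exact mul_le_of_le_one_right (norm_nonneg _) h2

theorem Psi_bound {ε a b : ℝ} (hε : 0 < ε) {u : XT n → ℝ} (hu : Continuous u)
    (hu0 : ∀ q ∈ ball (0 : XT n) (1 / 4), 0 ≤ u q) :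
    ∫ v in Ioc a b, ∫ q in ball (0 : XT n) (1 / 4), u q * Gm n ε v q ≤
      (√(8 * Real.pi) * √ε) * ∫ q in ball (0 : XT n) (1 / 4), u q := by
  rw [integral_integral_swap (Psi_int hε hu), ← integral_const_mul]
  refine setIntegral_mono_on ?_ ((u_intOn hu _).const_mul _) measurableSet_ball ?_
  · exact (Psi_int hε hu).integral_prod_right
  · intro q hq
    rw [integral_const_mul, mul_comm]
    refine mul_le_mul_of_nonneg_right ?_ (hu0 q hq)
    rw [← (Gm_integral hε q).2]
    refine setIntegral_le_integral (Gm_integral hε q).1 ?_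
    exact Filter.Eventually.of_forall fun v => by unfold Gm; positivity

/-- volume of the unit ball, as a mass constant -/
noncomputable def omg (n : ℕ) : ℝ :=
  Real.exp (-(1 / 2)) * (2 * volume.real (closedBall (0 : EuclideanSpace ℝ (Fin n)) 1))

theorem omg_pos : 0 < omg n := by
  unfold omg
  have : 0 < volume.real (closedBall (0 : EuclideanSpace ℝ (Fin n)) 1) := by
    refine ENNReal.toReal_pos ?_ ?_
    · exact (measure_closedBall_pos volume _ one_pos).ne'
    · exact measure_closedBall_lt_top.ne
  positivity

theorem mass_bound {ε v m : ℝ} (hε : 0 < ε) (hv : 0 < v) {F : XT n → ℝ} (hF : Continuous F)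
    (hc : HasCompactSupport F) (hF0 : ∀ q, 0 ≤ F q) (hm : 0 ≤ m)
    (hFm : ∀ q : XT n, ‖q.1‖ ≤ v → |q.2 + v ^ 2| ≤ √ε * v → m ≤ F q) :
    m * (omg n * √ε) ≤ ∫ q, F q * hker n ε v q := by
  set A : Set (XT n) := closedBall 0 v ×ˢ closedBall (-v ^ 2) (√ε * v) with hA
  have hvol : volume.real A = v ^ n * volume.real (closedBall (0 : EuclideanSpace ℝ (Fin n)) 1)
      * (2 * (√ε * v)) := by
    rw [hA, Measure.real, Measure.volume_eq_prod, Measure.prod_prod, ENNReal.toReal_mul,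
      Measure.addHaar_closedBall' volume _ hv.le, Real.volume_closedBall, ENNReal.toReal_mul,
      ENNReal.toReal_ofReal (by positivity), ENNReal.toReal_ofReal (by positivity)]
    simp [Measure.real]
  have hIntg : Integrable (fun q => F q * hker n ε v q) :=
    (hF.mul hker_contDiff.continuous).integrable_of_hasCompactSupport hc.mul_right
  have hAm : MeasurableSet A := measurableSet_closedBall.prod measurableSet_closedBall
  have hAf : volume A ≠ ⊤ :=
    ((isCompact_closedBall _ _).prod (isCompact_closedBall _ _)).measure_lt_top.ne
  have h1 : (m * ((v ^ (n + 1))⁻¹ * Real.exp (-(1 / 2)))) * volume.real A ≤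
      ∫ q in A, F q * hker n ε v q := by
    refine setIntegral_ge_of_const_le_real hAm hAf ?_ hIntg.integrableOn
    rintro q ⟨hq1, hq2⟩
    have a1 : ‖q.1‖ ≤ v := by simpa using hq1
    have a2 : |q.2 + v ^ 2| ≤ √ε * v := by
      have := mem_closedBall.1 hq2
      rw [Real.dist_eq] at this
      simpa using this
    refine mul_le_mul (hFm q a1 a2) ?_ (by positivity) (hF0 q)
    unfold hker
    gcongr
    have b1 : ‖q.1‖ ^ 2 / (4 * v ^ 2) ≤ 1 / 4 := by
      rw [div_le_div_iff₀ (by positivity) (by positivity)]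
      have : ‖q.1‖ ^ 2 ≤ v ^ 2 := by gcongr
      linarith
    have b2 : (q.2 + v ^ 2) ^ 2 / (4 * ε * v ^ 2) ≤ 1 / 4 := by
      rw [div_le_div_iff₀ (by positivity) (by positivity)]
      have : (q.2 + v ^ 2) ^ 2 ≤ (√ε * v) ^ 2 := sq_le_sq' (by
        linarith [(abs_le.1 a2).1]) (abs_le.1 a2).2
      rw [mul_pow, Real.sq_sqrt hε.le] at this
      linarith
    linarith
  have h2 : ∫ q in A, F q * hker n ε v q ≤ ∫ q, F q * hker n ε v q :=
    setIntegral_le_integral hIntg (Filter.Eventually.of_forall fun q =>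
      mul_nonneg (hF0 q) (hker_nonneg hv.le q))
  refine le_trans (le_of_eq ?_) (h1.trans h2)
  rw [hvol, omg]
  field_simp
  ring

end core

section core2
variable {n : ℕ}

/-- constant in the remainder estimate -/
noncomputable def cRem (n : ℕ) (K : ℝ) : ℝ :=
  2 * (K * (3 * n + 4)) * ((n + 2).factorial / (1 / 2048) ^ (n + 2))

theorem Rem_Gm {ε v K : ℝ} {φ : XT n → ℝ} (hε : 0 < ε) (hε1 : ε ≤ 1) (hv : 0 < v)
    (hv1 : v ≤ 1 / 4) (q : XT n) (hq : ‖q‖ ≤ 1 / 4) (hK : 0 ≤ K)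
    (hS : ∀ j, ∀ q, |dirD (eS j) φ q| ≤ K) (hSS : ∀ j, ∀ q, |dirD (eS j) (dirD (eS j) φ) q| ≤ K)
    (hT : ∀ q, |dirD (eT n) φ q| ≤ K) (hTT : ∀ q, |dirD (eT n) (dirD (eT n) φ) q| ≤ K)
    (h1 : ∀ q, ‖q‖ < 1 / 8 → φ =ᶠ[nhds q] fun _ => 1) :
    2 * v * |Rem ε φ (hker n ε v) q| ≤ cRem n K * Gm n ε v q := by
  have hc0 : 0 ≤ cRem n K := by unfold cRem; positivity
  rcases lt_or_ge ‖q‖ (1 / 8) with h | h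
  · have d1 : ∀ e, dirD e φ =ᶠ[nhds q] fun _ => 0 := fun e =>
      dirD_zero_of_eventuallyEq e q 1 (h1 q h)
    have d2 : ∀ e, dirD e (dirD e φ) q = 0 := fun e =>
      (dirD_zero_of_eventuallyEq e q 0 (d1 e)).eq_of_nhds
    have d1' : ∀ e, dirD e φ q = 0 := fun e => (d1 e).eq_of_nhds
    have : Rem ε φ (hker n ε v) q = 0 := by
      unfold Rem; simp [d1', d2]
    rw [this, abs_zero, mul_zero]
    unfold Gm; positivity
  · have b := Rem_bound hε hε1 hv hv1 q hq hK (fun j => hS j q) (fun j => hSS j q) (hT q) (hTT q)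
    have b2 := hker_bound2 hε hε1 hv hv1 q h
    calc 2 * v * |Rem ε φ (hker n ε v) q| 
        ≤ 2 * v * (K * (3 * n + 4) * ((v ^ 2)⁻¹ * hker n ε v q)) := by gcongr
      _ = 2 * (K * (3 * n + 4)) * (v⁻¹ * hker n ε v q) := by field_simp
      _ ≤ 2 * (K * (3 * n + 4)) * (((n + 2).factorial / (1 / 2048) ^ (n + 2)) * 
            Real.exp (-(1 / (8 * ε)) * (v - √(max (-q.2) 0)) ^ 2)) := by gcongr
      _ = _ := by unfold cRem Gm; ring

theorem J_ineq {ε v K C : ℝ} {φ u : XT n → ℝ} (hε : 0 < ε) (hε1 : ε ≤ 1) (hv : 0 < v)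
    (hv1 : v ≤ 1 / 4) (hK : 0 ≤ K) (hφ : ContDiff ℝ ∞ φ) (hφc : HasCompactSupport φ)
    (hφ0 : ∀ q, 0 ≤ φ q)
    (hS : ∀ j, ∀ q, |dirD (eS j) φ q| ≤ K) (hSS : ∀ j, ∀ q, |dirD (eS j) (dirD (eS j) φ) q| ≤ K)
    (hT : ∀ q, |dirD (eT n) φ q| ≤ K) (hTT : ∀ q, |dirD (eT n) (dirD (eT n) φ) q| ≤ K)
    (h1 : ∀ q, ‖q‖ < 1 / 8 → φ =ᶠ[nhds q] fun _ => 1)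
    (h2 : ∀ q, 1 / 4 ≤ ‖q‖ → φ =ᶠ[nhds q] fun _ => 0)
    (hu : ContDiff ℝ ∞ u) (hu0 : ∀ q ∈ ball (0 : XT n) (1 / 4), 0 ≤ u q)
    (hL : ∀ q ∈ ball (0 : XT n) (1 / 4), 0 ≤ Lop ε u q + C * u q) :
    -(cRem n K * ∫ q in ball (0 : XT n) (1 / 4), u q * Gm n ε v q) ≤
      2 * v * C * (∫ q, (u q * φ q) * hker n ε v q) + 
      ∫ q, (u q * φ q) * (2 * v * Lstar ε (hker n ε v) q) := by
  have hp := hker_contDiff (n := n) (ε := ε) (v := v)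
  set p := hker n ε v with hpdef
  have hout : ∀ q, q ∉ ball (0 : XT n) (1 / 4) → φ q = 0 ∧ Rem ε φ p q = 0 := by
    intro q hq
    have h : 1 / 4 ≤ ‖q‖ := by simpa using hq
    have d1 : ∀ e, dirD e φ =ᶠ[nhds q] fun _ => 0 := fun e =>
      dirD_zero_of_eventuallyEq e q 0 (h2 q h)
    have d2 : ∀ e, dirD e (dirD e φ) q = 0 := fun e =>
      (dirD_zero_of_eventuallyEq e q 0 (d1 e)).eq_of_nhds
    have d1' : ∀ e, dirD e φ q = 0 := fun e => (d1 e).eq_of_nhds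
    refine ⟨(h2 q h).eq_of_nhds, ?_⟩
    unfold Rem; simp [d1', d2]
  have hwc : HasCompactSupport (fun q => φ q * p q) := hφc.mul_right
  have hRc : HasCompactSupport (fun q => u q * Rem ε φ p q) := by
    refine HasCompactSupport.intro (isCompact_closedBall (0 : XT n) (1 / 4)) fun q hq => ?_
    rw [(hout q fun h => hq (ball_subset_closedBall h)).2, mul_zero]
  have iR : Integrable (fun q => u q * Rem ε φ p q) :=
    (hu.continuous.mul (Rem_continuous hφ hp)).integrable_of_hasCompactSupport hRc
  have iP : Integrable (fun q => (u q * φ q) * p q) :=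
    ((hu.continuous.mul hφ.continuous).mul hp.continuous).integrable_of_hasCompactSupport
      (hφc.mul_left.mul_right)
  have iL : Integrable (fun q => (u q * φ q) * Lstar ε p q) :=
    ((hu.continuous.mul hφ.continuous).mul 
      (Lstar_continuous hp)).integrable_of_hasCompactSupport (hφc.mul_left.mul_right)
  have iO : Integrable (fun q => Lop ε u q * (φ q * p q)) :=
    ((Lop_continuous hu).mul (hφ.continuous.mul hp.continuous)).integrable_of_hasCompactSupport
      hwc.mul_left
  have e1 := Lstar_ibp (ε := ε) hu (hφ.mul hp) hwc
  have e2 : ∀ q, u q * Lstar ε (fun q => φ q * p q) q = 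
      (u q * φ q) * Lstar ε p q + u q * Rem ε φ p q := by
    intro q; rw [Lstar_mul hφ hp]; ring
  simp_rw [e2] at e1
  rw [integral_add iL iR] at e1
  have e3 : 0 ≤ ∫ q, (Lop ε u q * (φ q * p q) + C * ((u q * φ q) * p q)) := by
    refine integral_nonneg fun q => ?_
    by_cases hq : q ∈ ball (0 : XT n) (1 / 4)
    · have := mul_nonneg (hL q hq) (mul_nonneg (hφ0 q) (hker_nonneg (ε := ε) hv.le q))
      simp only [Pi.zero_apply]
      rw [← hpdef] at this
      linarith
    · simp [(hout q hq).1]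
  rw [integral_add iO (iP.const_mul C), integral_const_mul] at e3
  have e4 : ∫ q, (u q * φ q) * (2 * v * Lstar ε p q) = 
      2 * v * ∫ q, (u q * φ q) * Lstar ε p q := by
    rw [← integral_const_mul]; congr 1; funext q; ring
  rw [e4]
  have e5 : 2 * v * ∫ q, u q * Rem ε φ p q ≤ 
      cRem n K * ∫ q in ball (0 : XT n) (1 / 4), u q * Gm n ε v q := by
    rw [← setIntegral_eq_integral_of_forall_compl_eq_zero (s := ball (0 : XT n) (1 / 4))
      (fun q hq => by rw [(hout q hq).2, mul_zero]), ← integral_const_mul, ← integral_const_mul]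
    refine setIntegral_mono_on (iR.integrableOn.const_mul _)
      ((u_intOn (hu.continuous.mul Gm_continuous') _).const_mul _) measurableSet_ball ?_
    intro q hq
    have hq' : ‖q‖ ≤ 1 / 4 := by
      have := mem_ball_zero_iff.1 hq
      exact this.le
    have b := Rem_Gm hε hε1 hv hv1 q hq' hK hS hSS hT hTT h1
    have b2 : 2 * v * Rem ε φ p q ≤ 2 * v * |Rem ε φ p q| := by
      gcongr; exact le_abs_self _
    have := mul_le_mul_of_nonneg_left (b2.trans b) (hu0 q hq)
    linarith
  have e6 : 0 ≤ 2 * v * ((∫ q, Lop ε u q * (φ q * p q)) + C * ∫ q, (u q * φ q) * p q) := by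
    positivity
  rw [← e1] at e6
  linarith

theorem cutoff_exists (n : ℕ) : ∃ (φ : XT n → ℝ) (K : ℝ), 0 ≤ K ∧ ContDiff ℝ ∞ φ ∧
    HasCompactSupport φ ∧ (∀ q, 0 ≤ φ q) ∧ (∀ q, φ q ≤ 1) ∧
    (∀ j, ∀ q, |dirD (eS j) φ q| ≤ K) ∧ (∀ j, ∀ q, |dirD (eS j) (dirD (eS j) φ) q| ≤ K) ∧
    (∀ q, |dirD (eT n) φ q| ≤ K) ∧ (∀ q, |dirD (eT n) (dirD (eT n) φ) q| ≤ K) ∧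
    (∀ q, ‖q‖ < 1 / 8 → φ =ᶠ[nhds q] fun _ => 1) ∧
    (∀ q, 1 / 4 ≤ ‖q‖ → φ =ᶠ[nhds q] fun _ => 0) := by
  let b : ContDiffBump (0 : XT n) := ⟨1 / 8, 1 / 5, by norm_num, by norm_num⟩
  have hb : ContDiff ℝ ∞ b := b.contDiff
  have hc : HasCompactSupport b := b.hasCompactSupport
  have bd : ∀ e : XT n, ∃ M : ℝ, ∀ q, |dirD e b q| ≤ M ∧ |dirD e (dirD e b) q| ≤ M := by
    intro e
    obtain ⟨M1, h1⟩ := (dirD_hasCompactSupport e hc).exists_bound_of_continuous 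
      (dirD_contDiff e hb).continuous
    obtain ⟨M2, h2⟩ := (dirD_hasCompactSupport e 
      (dirD_hasCompactSupport e hc)).exists_bound_of_continuous 
      (dirD_contDiff e (dirD_contDiff e hb)).continuous
    exact ⟨max M1 M2, fun q => ⟨(h1 q).trans (le_max_left _ _), (h2 q).trans (le_max_right _ _)⟩⟩
  choose M hM using bd
  have hM0 : ∀ e, 0 ≤ M e := fun e => (abs_nonneg _).trans (hM e 0).1
  have hsum : ∀ j : Fin n, M (eS j) ≤ ∑ j : Fin n, M (eS j) := fun j =>
    Finset.single_le_sum (f := fun j : Fin n => M (eS j)) (fun i _ => hM0 _) (Finset.mem_univ j)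
  have hs0 : 0 ≤ ∑ j : Fin n, M (eS j) := Finset.sum_nonneg fun i _ => hM0 _
  have hT0 := hM0 (eT n)
  refine ⟨b, ∑ j : Fin n, M (eS j) + M (eT n), by positivity, hb, hc, fun q => b.nonneg,
    fun q => b.le_one, ?_, ?_, ?_, ?_, ?_, ?_⟩
  · intro j q; linarith [(hM (eS j) q).1, hsum j]
  · intro j q; linarith [(hM (eS j) q).2, hsum j]
  · intro q; linarith [(hM (eT n) q).1]
  · intro q; linarith [(hM (eT n) q).2]
  · intro q hq
    exact b.eventuallyEq_one_of_mem_ball (mem_ball_zero_iff.2 hq)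
  · intro q hq
    have : q ∉ tsupport b := by
      rw [b.tsupport_eq, mem_closedBall_zero_iff, not_le]
      exact lt_of_lt_of_le (by norm_num) hq
    exact notMem_tsupport_iff_eventuallyEq.1 this

theorem core_ineq (n : ℕ) (C : ℝ) (hC : 0 ≤ C) : ∃ c : ℝ, 0 < c ∧ ∀ ε : ℝ, 0 < ε → ε ≤ 1 →
    ∀ u : XT n → ℝ, ContDiff ℝ ∞ u → (∀ q ∈ ball (0 : XT n) (1 / 4), 0 ≤ u q) →
    (∀ q ∈ ball (0 : XT n) (1 / 4), 0 ≤ Lop ε u q + C * u q) →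
    u 0 ≤ c * ∫ q in ball (0 : XT n) (1 / 4), u q := by
  obtain ⟨φ, K, hK, hφ, hφc, hφ0, hφ1, hS, hSS, hT, hTT, h1, h2⟩ := cutoff_exists n
  have hcR : 0 ≤ cRem n K := by unfold cRem; positivity
  set c1 : ℝ := Real.exp C * ((n + 2) * 4 ^ (n + 2) + cRem n K) with hc1
  have hc1p : 0 < c1 := by positivity
  have hom := omg_pos (n := n)
  refine ⟨4 * (c1 * √(8 * Real.pi)) / omg n, by positivity, ?_⟩
  intro ε hε hε1 u hu hu0 hL
  have hI0 : 0 ≤ ∫ q in ball (0 : XT n) (1 / 4), u q :=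
    setIntegral_nonneg measurableSet_ball hu0
  rcases le_or_gt (u 0) 0 with hneg | hpos
  · exact hneg.trans (by positivity)
  set g : XT n → ℝ := fun q => u q * φ q with hg
  have hgc : Continuous g := hu.continuous.mul hφ.continuous
  have hgs : HasCompactSupport g := hφc.mul_left
  have hφout : ∀ q, q ∉ ball (0 : XT n) (1 / 4) → φ q = 0 := fun q hq =>
    (h2 q (by simpa using hq)).eq_of_nhds
  have hg0 : ∀ q, 0 ≤ g q := by
    intro q
    by_cases hq : q ∈ ball (0 : XT n) (1 / 4)
    · exact mul_nonneg (hu0 q hq) (hφ0 q)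
    · simp [hg, hφout q hq]
  have hg00 : g 0 = u 0 := by
    have : φ 0 = 1 := (h1 0 (by simp)).eq_of_nhds
    simp [hg, this]
  set J : ℝ → ℝ := fun v => ∫ q, g q * hker n ε v q with hJ
  set Ψ : ℝ → ℝ := fun v => ∫ q in ball (0 : XT n) (1 / 4), u q * Gm n ε v q with hΨ
  have hΨ0 : ∀ v, 0 ≤ Ψ v := fun v => setIntegral_nonneg measurableSet_ball fun q hq =>
    mul_nonneg (hu0 q hq) (by unfold Gm; positivity)
  have hJ0 : ∀ v, 0 < v → 0 ≤ J v := fun v hv => integral_nonneg fun q =>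
    mul_nonneg (hg0 q) (hker_nonneg hv.le q)
  have hJΨ : ∀ v, 0 < v → v ^ (n + 1) * J v ≤ Ψ v := by
    intro v hv
    have iP : Integrable (fun q => g q * hker n ε v q) :=
      (hgc.mul hker_contDiff.continuous).integrable_of_hasCompactSupport hgs.mul_right
    simp only [hJ, hΨ]
    rw [← setIntegral_eq_integral_of_forall_compl_eq_zero (s := ball (0 : XT n) (1 / 4))
      (fun q hq => by simp [hg, hφout q hq]), ← integral_const_mul]
    refine setIntegral_mono_on (iP.integrableOn.const_mul _)
      (u_intOn (hu.continuous.mul Gm_continuous') _) measurableSet_ball ?_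
    intro q hq
    have b := hker_bound1 hε hv q
    have b0 : 0 ≤ v ^ (n + 1) * hker n ε v q := 
      mul_nonneg (by positivity) (hker_nonneg hv.le q)
    calc v ^ (n + 1) * (g q * hker n ε v q) 
        = u q * (φ q * (v ^ (n + 1) * hker n ε v q)) := by simp only [hg]; ring
      _ ≤ u q * (1 * (v ^ (n + 1) * hker n ε v q)) := by
        gcongr
        · exact hu0 q hq
        · exact hφ1 q
      _ ≤ u q * Gm n ε v q := by
        rw [one_mul]
        exact mul_le_mul_of_nonneg_left b (hu0 q hq)
  set J' : ℝ → ℝ := fun v => ∫ q, g q * (2 * v * Lstar ε (hker n ε v) q) with hJ'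
  have hJd : ∀ v, 0 < v → HasDerivAt J (J' v) v := fun v hv => J_hasDerivAt hε hv hgc hgs
  have hJi : ∀ v, 0 < v → v ≤ 1 / 4 → -(cRem n K * Ψ v) ≤ 2 * v * C * J v + J' v :=
    fun v hv hv1 => J_ineq hε hε1 hv hv1 hK hφ hφc hφ0 hS hSS hT hTT h1 h2 hu hu0 hL
  -- the weighted quantity
  set Φ : ℝ → ℝ := fun v => (1 - (4 * v) ^ (n + 2)) * (Real.exp (C * v ^ 2) * J v) with hΦ
  set Φ' : ℝ → ℝ := fun v => (-((n + 2 : ℕ) * (4 * v) ^ (n + 1) * 4)) * 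
    (Real.exp (C * v ^ 2) * J v) + (1 - (4 * v) ^ (n + 2)) * 
    (Real.exp (C * v ^ 2) * (C * (2 * v)) * J v + Real.exp (C * v ^ 2) * J' v) with hΦ'
  have hΦd : ∀ v, 0 < v → HasDerivAt Φ (Φ' v) v := by
    intro v hv
    have d0 : HasDerivAt (fun v : ℝ => 4 * v) 4 v := by
      simpa using (hasDerivAt_id v).const_mul (4 : ℝ)
    have d1 : HasDerivAt (fun v : ℝ => 1 - (4 * v) ^ (n + 2)) 
        (-((n + 2 : ℕ) * (4 * v) ^ (n + 1) * 4)) v := by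
      simpa using (d0.pow (n + 2)).const_sub 1
    have d2 : HasDerivAt (fun v : ℝ => Real.exp (C * v ^ 2)) 
        (Real.exp (C * v ^ 2) * (C * (2 * v))) v := by
      have : HasDerivAt (fun v : ℝ => v ^ 2) (2 * v) v := by simpa using hasDerivAt_pow 2 v
      exact (this.const_mul C).exp
    exact d1.mul (d2.mul (hJd v hv))
  have hΦi : ∀ v, 0 < v → v ≤ 1 / 4 → -(c1 * Ψ v) ≤ Φ' v := by
    intro v hv hv1
    have hexp : Real.exp (C * v ^ 2) ≤ Real.exp C := by
      apply Real.exp_le_exp.2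
      have : v ^ 2 ≤ 1 := by nlinarith
      nlinarith
    have hχ0 : 0 ≤ 1 - (4 * v) ^ (n + 2) := by
      have : (4 * v) ^ (n + 2) ≤ 1 := pow_le_one₀ (by positivity) (by linarith)
      linarith
    have hχ1 : 1 - (4 * v) ^ (n + 2) ≤ 1 := by
      have : 0 ≤ (4 * v) ^ (n + 2) := by positivity
      linarith
    have a1 : ((n + 2 : ℕ) * (4 * v) ^ (n + 1) * 4) * (Real.exp (C * v ^ 2) * J v) ≤
        Real.exp C * (((n : ℝ) + 2) * 4 ^ (n + 2)) * Ψ v := by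
      calc ((n + 2 : ℕ) * (4 * v) ^ (n + 1) * 4) * (Real.exp (C * v ^ 2) * J v) 
          = Real.exp (C * v ^ 2) * (((n : ℝ) + 2) * 4 ^ (n + 2)) * (v ^ (n + 1) * J v) := by
            push_cast; rw [mul_pow]; ring
        _ ≤ _ := by
            have := hJΨ v hv
            have := hJ0 v hv
            gcongr
    have a2 : -(Real.exp C * cRem n K * Ψ v) ≤ (1 - (4 * v) ^ (n + 2)) * 
        (Real.exp (C * v ^ 2) * (C * (2 * v)) * J v + Real.exp (C * v ^ 2) * J' v) := by
      have b1 := hJi v hv hv1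
      have hP : 0 ≤ cRem n K * Ψ v := mul_nonneg hcR (hΨ0 v)
      set E := Real.exp (C * v ^ 2) with hE
      have hE0 : 0 < E := Real.exp_pos _
      set χ := 1 - (4 * v) ^ (n + 2)
      have hχE : χ * E ≤ 1 * Real.exp C := mul_le_mul hχ1 hexp hE0.le zero_le_one
      have hχE0 : 0 ≤ χ * E := mul_nonneg hχ0 hE0.le
      have b2 := mul_le_mul_of_nonneg_left b1 hχE0
      have b3 := mul_le_mul_of_nonneg_right hχE hP
      nlinarith
    simp only [hΦ', hc1]
    linarith
  -- choose δ
  obtain ⟨ρ, hρ, hρg⟩ : ∃ ρ > 0, ∀ q : XT n, ‖q‖ < ρ → u 0 / 2 ≤ g q := by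
    have : ∀ᶠ q in nhds (0 : XT n), u 0 / 2 < g q :=
      hgc.continuousAt.eventually_const_lt (by rw [hg00]; linarith)
    obtain ⟨ρ, hρ, h⟩ := Metric.eventually_nhds_iff.1 this
    exact ⟨ρ, hρ, fun q hq => (h (by simpa using hq)).le⟩
  set δ : ℝ := min (1 / 8) (ρ / 3) with hδ
  have hδ0 : 0 < δ := by positivity
  have hδ8 : δ ≤ 1 / 8 := min_le_left _ _
  have hδρ : δ ≤ ρ / 3 := min_le_right _ _
  have hmass : u 0 / 2 * (omg n * √ε) ≤ J δ := by
    refine mass_bound hε hδ0 hgc hgs hg0 (by linarith) ?_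
    intro q hq1 hq2
    apply hρg
    rw [Prod.norm_def]
    refine max_lt (by linarith) ?_
    have s1 : √ε ≤ 1 := Real.sqrt_le_one.2 hε1
    have s2 : √ε * δ ≤ 1 * δ := by gcongr
    have s3 : δ ^ 2 ≤ δ := by nlinarith
    rw [Real.norm_eq_abs, abs_lt]
    rw [abs_le] at hq2
    constructor <;> nlinarith [hq2.1, hq2.2]
  have hΦδ : u 0 / 4 * (omg n * √ε) ≤ Φ δ := by
    have s1 : (4 * δ) ^ (n + 2) ≤ 1 / 2 := by
      calc (4 * δ) ^ (n + 2) ≤ (1 / 2) ^ (n + 2) := by gcongr; linarith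
        _ ≤ (1 / 2) ^ 1 := pow_le_pow_of_le_one (by norm_num) (by norm_num) (by omega)
        _ = 1 / 2 := by norm_num
    have s2 : 1 ≤ Real.exp (C * δ ^ 2) := Real.one_le_exp (by positivity)
    have s3 := hJ0 δ hδ0
    have s4 : J δ ≤ Real.exp (C * δ ^ 2) * J δ := le_mul_of_one_le_left s3 s2
    have s5 : 1 / 2 * J δ ≤ Φ δ := by
      simp only [hΦ]
      exact mul_le_mul (by linarith) s4 s3 (by linarith)
    linarith
  have hΨint : IntegrableOn (fun v => -(c1 * Ψ v)) (Icc δ (1 / 4)) := by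
    rw [integrableOn_Icc_iff_integrableOn_Ioc]
    exact ((Psi_int hε hu.continuous).integral_prod_left.const_mul c1).neg
  have hFTC := intervalIntegral.integral_le_sub_of_hasDeriv_right_of_le (a := δ) (b := 1 / 4)
    (g := Φ) (g' := Φ') (by linarith)
    (fun v hv => (hΦd v (hδ0.trans_le hv.1)).continuousAt.continuousWithinAt)
    (fun v hv => (hΦd v (hδ0.trans hv.1)).hasDerivWithinAt) hΨint
    (fun v hv => hΦi v (hδ0.trans hv.1) hv.2.le)
  have hΦ4 : Φ (1 / 4) = 0 := by simp [hΦ]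
  rw [hΦ4, intervalIntegral.integral_neg, intervalIntegral.integral_const_mul,
    intervalIntegral.integral_of_le (by linarith)] at hFTC
  have hPB := Psi_bound (a := δ) (b := 1 / 4) hε hu.continuous hu0
  have fin1 : u 0 / 4 * (omg n * √ε) ≤ 
      c1 * ((√(8 * Real.pi) * √ε) * ∫ q in ball (0 : XT n) (1 / 4), u q) := by
    have := mul_le_mul_of_nonneg_left hPB hc1p.le
    linarith
  have hs : 0 < √ε := Real.sqrt_pos.2 hε
  have fin2 : u 0 / 4 * omg n ≤ 
      c1 * (√(8 * Real.pi) * ∫ q in ball (0 : XT n) (1 / 4), u q) := by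
    refine le_of_mul_le_mul_right ?_ hs
    linarith
  rw [div_mul_eq_mul_div, le_div_iff₀ hom]
  linarith

end core2

theorem ball_scale {E : Type*} [NormedAddCommGroup E] [NormedSpace ℝ E] [MeasurableSpace E]
    [BorelSpace E] [FiniteDimensional ℝ E] (μ : Measure E) [μ.IsAddHaarMeasure]
    (h : E → ℝ) (x : E) (r a : ℝ) (hr : 0 < r) :
    ∫ y in ball (0 : E) a, h (x + r • y) ∂μ
      = (r ^ Module.finrank ℝ E)⁻¹ * ∫ z in ball x (r * a), h z ∂μ := by
  have h1 := Measure.setIntegral_comp_smul_of_pos μ (fun z => h (x + z)) (ball (0 : E) a) hr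
  rw [h1, _root_.smul_ball hr.ne', smul_zero, Real.norm_of_nonneg hr.le, smul_eq_mul]
  congr 1
  rw [← integral_indicator measurableSet_ball, ← integral_indicator measurableSet_ball,
    ← integral_add_left_eq_self ((ball x (r * a)).indicator fun z => h z) x]
  congr 1
  funext z
  simp only [indicator, mem_ball, dist_zero_right, dist_self_add_left]

theorem hyp_conv {n : ℕ} (ε : ℝ) (f : EuclideanSpace ℝ (Fin n) → ℝ → ℝ)
    (hf : ContDiff ℝ ∞ (fun p : XT n => f p.1 p.2)) (x : EuclideanSpace ℝ (Fin n)) (t : ℝ) :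
    -ε * deriv (fun s => deriv (fun s' => f x s') s) t
            + deriv (fun s => f x s) t
            - spatialLaplacian (fun y => f y t) x
      = - Lop ε (fun p : XT n => f p.1 p.2) (x, t) := by
  set u : XT n → ℝ := fun p : XT n => f p.1 p.2 with hu
  have e1 : (fun s' => f x s') = fun s : ℝ => u ((x, 0) + ContinuousLinearMap.inr ℝ _ _ s) := by
    funext s; simp [hu]
  have e2 : (fun y => f y t) = fun y => u ((0, t) + ContinuousLinearMap.inl ℝ _ _ y) := by
    funext s; simp [hu]
  have t1 : deriv (fun s => f x s) t = dirD (eT n) u (x, t) := by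
    have := congrFun (dirD_comp hf (ContinuousLinearMap.inr ℝ (EuclideanSpace ℝ (Fin n)) ℝ)
      (x, 0) 1 (eT n) 1 (by simp [eT])) t
    rw [← e1] at this
    simp only [ContinuousLinearMap.inr_apply, Prod.mk_add_mk, add_zero, zero_add, one_mul] at this
    exact this
  have t2 : deriv (fun s => deriv (fun s' => f x s') s) t = dirD (eT n) (dirD (eT n) u) (x, t) := by
    have := congrFun (dirD2_comp hf (ContinuousLinearMap.inr ℝ (EuclideanSpace ℝ (Fin n)) ℝ)
      (x, 0) 1 (eT n) 1 (by simp [eT])) t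
    rw [← e1] at this
    simp only [ContinuousLinearMap.inr_apply, Prod.mk_add_mk, add_zero, zero_add, one_mul,
      one_pow] at this
    exact this
  have t3 : spatialLaplacian (fun y => f y t) x = ∑ j, dirD (eS j) (dirD (eS j) u) (x, t) := by
    unfold spatialLaplacian
    refine Finset.sum_congr rfl fun j _ => ?_
    have := congrFun (dirD2_comp hf (ContinuousLinearMap.inl ℝ (EuclideanSpace ℝ (Fin n)) ℝ)
      (0, t) (EuclideanSpace.single j 1) (eS j) 1 (by simp [eS])) x
    rw [← e2] at this
    simp only [ContinuousLinearMap.inl_apply, Prod.mk_add_mk, add_zero, zero_add, one_mul,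
      one_pow] at this
    exact this
  rw [t1, t2, t3]
  unfold Lop
  ring

theorem Lop_scale {n : ℕ} (ε r : ℝ) (hr : 0 < r) (u : XT n → ℝ) (hu : ContDiff ℝ ∞ u) (p q : XT n)
    (L : XT n →L[ℝ] XT n) (hS : ∀ j, L (eS j) = r • eS j) (hT : L (eT n) = (r ^ 2) • eT n) :
    Lop (ε / r ^ 2) (fun q => u (p + L q)) q = r ^ 2 * Lop ε u (p + L q) := by
  unfold Lop
  rw [dirD2_comp hu L p _ _ _ hT, dirD_comp hu L p _ _ _ hT]
  have : ∀ j : Fin n, dirD (eS j) (dirD (eS j) (fun q => u (p + L q))) q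
      = r ^ 2 * dirD (eS j) (dirD (eS j) u) (p + L q) := fun j => by
    rw [dirD2_comp hu L p _ _ _ (hS j)]
  simp only [this, ← Finset.mul_sum]
  field_simp

theorem final_int {n : ℕ} (r : ℝ) (hr : 0 < r) (x₀ x : EuclideanSpace ℝ (Fin n)) (t₀ t : ℝ)
    (f : EuclideanSpace ℝ (Fin n) → ℝ → ℝ)
    (hf : Continuous (fun p : XT n => f p.1 p.2))
    (hpos : ∀ x ∈ ball x₀ r, ∀ t ∈ Ioo (t₀ - r ^ 2) (t₀ + r ^ 2), 0 ≤ f x t)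
    (hx : x ∈ ball x₀ (r / 2)) (ht : t ∈ Ioo (t₀ - r ^ 2 / 4) (t₀ + r ^ 2 / 4)) :
    ∫ q in ball (0 : XT n) (1 / 4), f (x + r • q.1) (t + r ^ 2 * q.2)
      ≤ (r ^ (n + 2))⁻¹ * 
        ∫ t' in Ioo (t₀ - r ^ 2) (t₀ + r ^ 2), ∫ x' in ball x₀ r, f x' t' := by
  have hr2 : 0 < r ^ 2 := by positivity
  have hbs : ball x (r * (1 / 4)) ⊆ ball x₀ r := by
    intro z hz
    rw [mem_ball] at *
    have := dist_triangle z x x₀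
    linarith
  have hbt : ball t (r ^ 2 * (1 / 4)) ⊆ Ioo (t₀ - r ^ 2) (t₀ + r ^ 2) := by
    intro z hz
    rw [Real.ball_eq_Ioo] at hz
    constructor <;> linarith [hz.1, hz.2, ht.1, ht.2]
  have hIntg : ∀ t, IntegrableOn (fun z => f z t) (ball x₀ r) := fun t => by
    have hc : Continuous (fun z => f z t) := hf.comp (by fun_prop : Continuous fun z => ((z, t) : XT n))
    exact (hc.continuousOn.integrableOn_compact (isCompact_closedBall x₀ r)).mono_set
      ball_subset_closedBall
  have hQ : IntegrableOn (fun p : XT n => f p.1 p.2) (ball x₀ r ×ˢ Ioo (t₀ - r ^ 2) (t₀ + r ^ 2)) :=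
    (hf.continuousOn.integrableOn_compact ((isCompact_closedBall x₀ r).prod isCompact_Icc)).mono_set
      (prod_mono ball_subset_closedBall Ioo_subset_Icc_self)
  have hO : IntegrableOn (fun t' => ∫ x' in ball x₀ r, f x' t') (Ioo (t₀ - r ^ 2) (t₀ + r ^ 2)) := by
    unfold IntegrableOn at hQ ⊢
    rw [Measure.volume_eq_prod, ← Measure.prod_restrict] at hQ
    exact hQ.integral_prod_right
  have hQ' : IntegrableOn (fun q : XT n => f (x + r • q.1) (t + r ^ 2 * q.2))
      (ball (0 : EuclideanSpace ℝ (Fin n)) (1 / 4) ×ˢ ball (0 : ℝ) (1 / 4)) := by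
    have hc : Continuous (fun q : XT n => f (x + r • q.1) (t + r ^ 2 * q.2)) :=
      hf.comp (by fun_prop : Continuous fun q : XT n => ((x + r • q.1, t + r ^ 2 * q.2) : XT n))
    exact (hc.continuousOn.integrableOn_compact
      ((isCompact_closedBall _ _).prod (isCompact_closedBall _ _))).mono_set
      (prod_mono ball_subset_closedBall ball_subset_closedBall)
  have E1 : ∫ q in ball (0 : XT n) (1 / 4), f (x + r • q.1) (t + r ^ 2 * q.2)
      = ∫ s in ball (0 : ℝ) (1 / 4), ∫ y in ball (0 : EuclideanSpace ℝ (Fin n)) (1 / 4),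
          f (x + r • y) (t + r ^ 2 • s) := by
    have hb : ball (0 : XT n) (1 / 4)
      = ball (0 : EuclideanSpace ℝ (Fin n)) (1 / 4) ×ˢ ball (0 : ℝ) (1 / 4) :=
      (ball_prod_same _ _ _).symm
    unfold IntegrableOn at hQ'
    rw [Measure.volume_eq_prod, ← Measure.prod_restrict] at hQ'
    rw [hb, Measure.volume_eq_prod, ← Measure.prod_restrict, integral_prod_symm _ hQ']
    rfl
  have E2 : ∀ t', ∫ y in ball (0 : EuclideanSpace ℝ (Fin n)) (1 / 4), f (x + r • y) t'
      = (r ^ n)⁻¹ * ∫ z in ball x (r * (1 / 4)), f z t' := fun t' => by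
    have := ball_scale volume (fun z => f z t') x r (1 / 4) hr
    simpa using this
  have E3 := ball_scale volume (fun t' => (r ^ n)⁻¹ * ∫ z in ball x (r * (1 / 4)), f z t')
    t (r ^ 2) (1 / 4) hr2
  rw [E1]
  simp only [E2]
  rw [E3, integral_const_mul, Module.finrank_self, pow_one, ← mul_assoc, ← mul_inv, ← pow_add,
    add_comm 2 n]
  refine mul_le_mul_of_nonneg_left ?_ (by positivity)
  calc ∫ t' in ball t (r ^ 2 * (1 / 4)), ∫ z in ball x (r * (1 / 4)), f z t'
      ≤ ∫ t' in ball t (r ^ 2 * (1 / 4)), ∫ z in ball x₀ r, f z t' := by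
        refine integral_mono_of_nonneg ?_ (hO.mono_set hbt) ?_
        · filter_upwards [ae_restrict_mem measurableSet_ball] with t' ht'
          exact setIntegral_nonneg measurableSet_ball fun z hz => hpos z (hbs hz) t' (hbt ht')
        · filter_upwards [ae_restrict_mem measurableSet_ball] with t' ht'
          refine setIntegral_mono_set (hIntg t') ?_ hbs.eventuallyLE
          filter_upwards [ae_restrict_mem measurableSet_ball] with z hz
          exact hpos z hz t' (hbt ht')
    _ ≤ _ := by
        refine setIntegral_mono_set hO ?_ hbt.eventuallyLE
        filter_upwards [ae_restrict_mem measurableSet_Ioo] with t' ht'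
        exact setIntegral_nonneg measurableSet_ball fun z hz => hpos z hz t' ht'

/-- A uniform (in `ε ≤ r²`) Moser–Harnack inequality for nonnegative smooth
subsolutions of the elliptic regularization `−ε ∂²ₜ f + ∂ₜ f − Δf ≤ C f`:
`sup_{P_{r/2}} f ≤ (c/r^{n+2}) ∬_{P_r} f`. -/
theorem stmt_2 (n : ℕ) (hn : 1 ≤ n) (C : ℝ) (hC : 0 ≤ C) :
    ∃ c : ℝ, 0 < c ∧
      ∀ (r ε : ℝ), 0 < r → r ≤ 1 → 0 < ε → ε ≤ r ^ 2 →
      ∀ (x₀ : EuclideanSpace ℝ (Fin n)) (t₀ : ℝ)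
        (f : EuclideanSpace ℝ (Fin n) → ℝ → ℝ),
        ContDiff ℝ (⊤ : ℕ∞) (fun p : EuclideanSpace ℝ (Fin n) × ℝ => f p.1 p.2) →
        (∀ x ∈ ball x₀ r, ∀ t ∈ Ioo (t₀ - r ^ 2) (t₀ + r ^ 2), 0 ≤ f x t) →
        (∀ x ∈ ball x₀ r, ∀ t ∈ Ioo (t₀ - r ^ 2) (t₀ + r ^ 2),
          -ε * deriv (fun s => deriv (fun s' => f x s') s) t
            + deriv (fun s => f x s) t
            - spatialLaplacian (fun y => f y t) x ≤ C * f x t) →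
        ∀ x ∈ ball x₀ (r / 2), ∀ t ∈ Ioo (t₀ - r ^ 2 / 4) (t₀ + r ^ 2 / 4),
          f x t ≤ (c / r ^ (n + 2)) *
            ∫ t' in Ioo (t₀ - r ^ 2) (t₀ + r ^ 2), ∫ x' in ball x₀ r, f x' t' := by
  obtain ⟨c, hc, H⟩ := core_ineq n C hC
  refine ⟨c, hc, ?_⟩
  intro r ε hr hr1 hε hεr x₀ t₀ f hf hpos hsub x hx t ht
  have hr2 : 0 < r ^ 2 := by positivity
  set u : XT n → ℝ := fun p => f p.1 p.2 with hu
  let L : XT n →L[ℝ] XT n := (r • ContinuousLinearMap.fst ℝ (EuclideanSpace ℝ (Fin n)) ℝ).prod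
    (r ^ 2 • ContinuousLinearMap.snd ℝ (EuclideanSpace ℝ (Fin n)) ℝ)
  have hLa : ∀ q : XT n, L q = (r • q.1, r ^ 2 * q.2) := fun q => by simp [L]
  have hmem : ∀ q ∈ ball (0 : XT n) (1 / 4), x + r • q.1 ∈ ball x₀ r ∧
      t + r ^ 2 * q.2 ∈ Ioo (t₀ - r ^ 2) (t₀ + r ^ 2) := by
    intro q hq
    rw [mem_ball_zero_iff, Prod.norm_def, max_lt_iff] at hq
    obtain ⟨h1, h2⟩ := hq
    rw [Real.norm_eq_abs, abs_lt] at h2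
    constructor
    · rw [mem_ball] at *
      have h3 := dist_triangle (x + r • q.1) x x₀
      rw [dist_self_add_left, norm_smul, Real.norm_of_nonneg hr.le] at h3
      nlinarith
    · constructor <;> nlinarith [ht.1, ht.2, h2.1, h2.2]
  have h := H (ε / r ^ 2) (by positivity) ((div_le_one hr2).2 hεr) (fun q => u ((x, t) + L q))
    (hf.comp (contDiff_const.add L.contDiff)) ?_ ?_
  · have hi := final_int r hr x₀ x t₀ t f hf.continuous hpos hx ht
    have e0 : u ((x, t) + L 0) = f x t := by simp [hu]
    have e1 : ∀ q, u ((x, t) + L q) = f (x + r • q.1) (t + r ^ 2 * q.2) := fun q => by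
      simp [hu, hLa]
    simp only [e0, e1] at h
    rw [e0] at *
    calc f x t ≤ _ := h
      _ ≤ _ := mul_le_mul_of_nonneg_left hi hc.le
      _ = _ := by rw [div_eq_mul_inv, mul_assoc]
  · intro q hq
    have := hpos _ (hmem q hq).1 _ (hmem q hq).2
    simpa [hu, hLa] using this
  · intro q hq
    rw [Lop_scale ε r hr u hf (x, t) q L (fun j => by rw [hLa]; simp [eS])
      (by rw [hLa]; simp [eT])]
    have hp := hpos _ (hmem q hq).1 _ (hmem q hq).2
    have hs := hsub _ (hmem q hq).1 _ (hmem q hq).2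
    rw [hyp_conv ε f hf] at hs
    have e2 : (x, t) + L q = (x + r • q.1, t + r ^ 2 * q.2) := by simp [hLa]
    rw [e2]
    have e3 : u (x + r • q.1, t + r ^ 2 * q.2) = f (x + r • q.1) (t + r ^ 2 * q.2) := rfl
    rw [e3]
    have h1 : r ^ 2 ≤ 1 := by nlinarith
    have h4 : 0 ≤ C * f (x + r • q.1) (t + r ^ 2 * q.2) := mul_nonneg hC hp
    have h5 : -(C * f (x + r • q.1) (t + r ^ 2 * q.2)) ≤
      Lop ε u (x + r • q.1, t + r ^ 2 * q.2) := by linarith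
    nlinarith [mul_le_mul_of_nonneg_left h5 hr2.le]
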